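/- The prefix palindromic length p of the Sierpinski word satisfies: p(0) = 0, p(1) = 1, p(n) = 2 for 3^k < n ≤ 2·3^k, and p(n) = min(2 + q(n − 2·3^k), 1 + p(3^(k+1) − n)) for 2·3^k < n ≤ 3^(k+1). -/

import Mathlib

/-- A palindrome: a word equal to its reversal. -/
def IsPal {α : Type*} (w : List α) : Prop := w.reverse = w

/-- Palindromic length: the minimal number of palindromes whose concatenation is `w`. -/
noncomputable def PL {α : Type*} (w : List α) : ℕ :=
  sInf {k | ∃ l : List (List α), l.length = k ∧ (∀ p ∈ l, IsPal p) ∧ l.flatten = w}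


/-- The morphism φ : a → aba, b → bbb, with a = false, b = true. -/
def phi (w : List Bool) : List Bool :=
  w.flatMap fun c => if c then [true, true, true] else [false, true, false]

/-- The Sierpinski word, fixed point of φ starting with a: its (n+1)-st letter. -/
def sW (n : ℕ) : Bool := (phi^[n+1] [false]).getD n true

/-- The prefix s[1..n] of the Sierpinski word. -/
def sPrefix (n : ℕ) : List Bool := (List.range n).map sW

/-- qⱼ(n) = PL(bʲ s[1..n]). -/
noncomputable def qj (j n : ℕ) : ℕ := PL (List.replicate j true ++ sPrefix n)

/-- q(n) = min over j of qⱼ(n). -/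
noncomputable def qS (n : ℕ) : ℕ := sInf (Set.range fun j => qj j n)

/-- p(n) = PL(s[1..n]), the prefix palindromic length of the Sierpinski word. -/
noncomputable def pS (n : ℕ) : ℕ := PL (sPrefix n)

/-- `w` is a concatenation of `k` (possibly empty) palindromes. -/
def PalFactor {α : Type*} (w : List α) (k : ℕ) : Prop :=
  ∃ l : List (List α), l.length = k ∧ (∀ p ∈ l, IsPal p) ∧ l.flatten = w

section PalindromicLength

variable {α : Type*}

theorem PalFactor.nil : PalFactor ([] : List α) 0 := ⟨[], by simp⟩

theorem IsPal.palFactor {w : List α} (h : IsPal w) : PalFactor w 1 := ⟨[w], by simpa using h⟩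

theorem PalFactor.append {u v : List α} {a b : ℕ} (hu : PalFactor u a) (hv : PalFactor v b) :
    PalFactor (u ++ v) (a + b) := by
  obtain ⟨l, rfl, hl, rfl⟩ := hu
  obtain ⟨l', rfl, hl', rfl⟩ := hv
  refine ⟨l ++ l', by simp, fun p hp => ?_, by simp⟩
  rcases List.mem_append.1 hp with h | h
  exacts [hl p h, hl' p h]

theorem PalFactor.mono {w : List α} {a b : ℕ} (h : PalFactor w a) (hab : a ≤ b) :
    PalFactor w b := by
  induction b, hab using Nat.le_induction with
  | base => exact h
  | succ n _ ih =>
    have h := ih.append (IsPal.palFactor (w := ([] : List α)) rfl)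
    rwa [List.append_nil] at h

theorem palFactor_length (w : List α) : PalFactor w w.length := by
  induction w with
  | nil => exact PalFactor.nil
  | cons c w ih =>
    have h := (IsPal.palFactor (w := [c]) rfl).append ih
    rwa [Nat.add_comm] at h

theorem palFactor_PL (w : List α) : PalFactor w (PL w) :=
  Nat.sInf_mem (s := {k | PalFactor w k}) ⟨_, palFactor_length w⟩

theorem PL_le_iff {w : List α} {k : ℕ} : PL w ≤ k ↔ PalFactor w k :=
  ⟨fun h => (palFactor_PL w).mono h, fun h => Nat.sInf_le (s := {k | PalFactor w k}) h⟩

theorem palFactor_zero {w : List α} : PalFactor w 0 ↔ w = [] := by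
  constructor
  · rintro ⟨l, hl, -, rfl⟩
    simp [List.length_eq_zero_iff.1 hl]
  · rintro rfl
    exact PalFactor.nil

theorem palFactor_one {w : List α} : PalFactor w 1 ↔ IsPal w := by
  constructor
  · rintro ⟨l, hl, hp, rfl⟩
    obtain ⟨p, rfl⟩ := List.length_eq_one_iff.1 hl
    simpa using hp
  · exact IsPal.palFactor

theorem PalFactor.pos {w : List α} {k : ℕ} (h : PalFactor w k) (hw : w ≠ []) : 1 ≤ k := by
  rcases k with _ | k
  · exact absurd (palFactor_zero.1 h) hw
  · omega

theorem IsPal.reverse {w : List α} (h : IsPal w) : IsPal w.reverse := by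
  rw [IsPal, List.reverse_reverse, h]

theorem PalFactor.reverse {w : List α} {k : ℕ} (h : PalFactor w k) : PalFactor w.reverse k := by
  obtain ⟨l, rfl, hp, rfl⟩ := h
  induction l with
  | nil => exact PalFactor.nil
  | cons p l ih =>
    rw [List.flatten_cons, List.reverse_append, List.length_cons]
    exact (ih fun q hq => hp q (by simp [hq])).append (hp p (by simp)).reverse.palFactor

/-- A palindromic factorization of `u ++ v` either has a cut between `u` and `v`, or one of its
palindromes straddles the boundary. -/
theorem PalFactor.split {u v : List α} {t : ℕ} (h : PalFactor (u ++ v) t) :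
    (∃ a b, a + b = t ∧ PalFactor u a ∧ PalFactor v b) ∨
    ∃ u₁ x y v₂ a b, u = u₁ ++ x ∧ v = y ++ v₂ ∧ x ≠ [] ∧ y ≠ [] ∧ IsPal (x ++ y) ∧
      a + b + 1 = t ∧ PalFactor u₁ a ∧ PalFactor v₂ b := by
  obtain ⟨l, rfl, hp, hl⟩ := h
  induction l generalizing u with
  | nil =>
    obtain ⟨rfl, rfl⟩ := List.append_eq_nil_iff.1 hl.symm
    exact Or.inl ⟨0, 0, rfl, .nil, .nil⟩
  | cons p l ih =>
    have hpal : IsPal p := hp p (by simp)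
    have hp' : ∀ q ∈ l, IsPal q := fun q hq => hp q (by simp [hq])
    rw [List.flatten_cons, List.append_eq_append_iff] at hl
    rcases hl with ⟨u', rfl, hl⟩ | ⟨y, rfl, rfl⟩
    · rcases ih hp' hl with ⟨a, b, hab, hu, hv⟩ |
        ⟨u₁, x, y, v₂, a, b, rfl, rfl, hx, hy, hxy, hab, hu, hv⟩
      · exact Or.inl ⟨1 + a, b, by simp; omega, hpal.palFactor.append hu, hv⟩
      · exact Or.inr ⟨p ++ u₁, x, y, v₂, 1 + a, b, by simp, rfl, hx, hy, hxy, by simp; omega,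
          hpal.palFactor.append hu, hv⟩
    · have hl' : PalFactor l.flatten l.length := ⟨l, rfl, hp', rfl⟩
      by_cases hu : u = []
      · subst hu
        exact Or.inl ⟨0, 1 + l.length, by simp; omega, .nil, hpal.palFactor.append hl'⟩
      by_cases hy : y = []
      · subst hy
        rw [List.append_nil] at hpal
        exact Or.inl ⟨1, l.length, by simp; omega, hpal.palFactor, hl'⟩
      · exact Or.inr ⟨[], u, y, l.flatten, 0, l.length, rfl, rfl, hu, hy, hpal, by simp, .nil, hl'⟩

/-- If a palindrome has a palindromic suffix, the complementary prefix is a product of two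
palindromes. -/
theorem IsPal.exists_append_of_suffix {z y : List α} (hy : IsPal y) (h : IsPal (z ++ y)) :
    ∃ a b, z = a ++ b ∧ IsPal a ∧ IsPal b := by
  induction hn : y.length using Nat.strong_induction_on generalizing y with
  | _ n ih =>
    subst hn
    have hzy : y ++ z.reverse = z ++ y := by
      have h' := h
      rwa [IsPal, List.reverse_append, hy] at h'
    rcases List.append_eq_append_iff.1 hzy with ⟨z', rfl, hz⟩ | ⟨y', rfl, hz⟩
    · refine ⟨y, z', rfl, hy, ?_⟩
      rw [List.reverse_append, hy] at hz
      exact List.append_cancel_right hz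
    · by_cases hz0 : z = []
      · subst hz0
        exact ⟨[], [], rfl, rfl, rfl⟩
      · refine ih y'.length ?_ ?_ hy rfl
        · have := List.length_pos_iff.2 hz0
          simp; omega
        · have h1 := hy
          rw [IsPal, List.reverse_append, hz] at h1
          exact (List.append_inj' h1 rfl).1

theorem PalFactor.of_append_isPal {x y : List α} {t : ℕ} (h : PalFactor (x ++ y) t)
    (hy : IsPal y) : PalFactor x (t + 1) := by
  induction hn : y.length using Nat.strong_induction_on generalizing x y t with
  | _ n ih =>
    subst hn
    by_cases hy0 : y = []
    · subst hy0
      rw [List.append_nil] at h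
      exact h.mono (by omega)
    obtain ⟨l, rfl, hp, hl⟩ := h
    induction l using List.reverseRecOn with
    | nil =>
      exact absurd (List.append_eq_nil_iff.1 hl.symm).2 hy0
    | append_singleton l p ihl =>
      have hpal : IsPal p := hp p (by simp)
      have hp' : ∀ q ∈ l, IsPal q := fun q hq => hp q (by simp [hq])
      have hl' : PalFactor l.flatten l.length := ⟨l, rfl, hp', rfl⟩
      rw [List.flatten_append, List.flatten_singleton] at hl
      rw [List.length_append, List.length_singleton]
      rcases List.append_eq_append_iff.1 hl with ⟨z, rfl, rfl⟩ | ⟨z, hz, rfl⟩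
      · obtain ⟨a, b, rfl, ha, hb⟩ := hy.exists_append_of_suffix hpal
        exact hl'.append (ha.palFactor.append hb.palFactor)
      · by_cases hp0 : p = []
        · subst hp0
          exact (ihl hp' (by simpa using hl)).mono (by omega)
        · obtain ⟨a, b, rfl, ha, hb⟩ := hpal.exists_append_of_suffix hy
          have := List.length_pos_iff.2 hp0
          rw [hz, ← List.append_assoc] at hl'
          exact ih a.length (by simp; omega) (ih b.length (by simp; omega) hl' hb rfl) ha rfl

/-- Triangle inequality for the palindromic length. -/
theorem PalFactor.of_append {x y : List α} {s t : ℕ} (h : PalFactor (x ++ y) t)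
    (hy : PalFactor y s) : PalFactor x (t + s) := by
  obtain ⟨l, rfl, hp, rfl⟩ := hy
  induction l using List.reverseRecOn generalizing t with
  | nil => simpa using h
  | append_singleton l p ih =>
    rw [List.flatten_append, List.flatten_singleton, ← List.append_assoc] at h
    have := ih (fun q hq => hp q (by simp [hq])) (h.of_append_isPal (hp p (by simp)))
    rw [List.length_append, List.length_singleton]
    exact this.mono (by omega)

theorem isPal_replicate (n : ℕ) (c : α) : IsPal (List.replicate n c) := List.reverse_replicate

theorem IsPal.lt_length_of_replicate {c : α} {i : ℕ} {y : List α}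
    (h : IsPal (List.replicate i c ++ y)) (hy : ∃ d ∈ y, d ≠ c) : i < y.length := by
  by_contra! hi
  obtain ⟨d, hd, hdc⟩ := hy
  rw [IsPal, List.reverse_append, List.reverse_replicate] at h
  rcases List.append_eq_append_iff.1 h with ⟨z, hz, -⟩ | ⟨z, hz, -⟩
  · exact hdc (List.eq_of_mem_replicate (n := i) (hz ▸ by simp [hd]))
  · have hlen := congrArg List.length hz
    simp at hlen
    obtain rfl : z = [] := List.length_eq_zero_iff.1 (by omega)
    rw [List.append_nil] at hz
    exact hdc (List.eq_of_mem_replicate (n := i) (hz ▸ by simp [hd]))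

end PalindromicLength

section SierpinskiBlocks

/-- The `k`-th iterate of the Sierpinski morphism on the letter `a`. -/
def sBlock (k : ℕ) : List Bool := phi^[k] [false]

theorem phi_append (u v : List Bool) : phi (u ++ v) = phi u ++ phi v := List.flatMap_append

theorem phi_replicate_true (n : ℕ) :
    phi (List.replicate n true) = List.replicate (3 * n) true := by
  induction n with
  | zero => rfl
  | succ n ih =>
    rw [List.replicate_succ', phi_append, ih, show 3 * (n + 1) = 3 * n + 3 by ring,
      List.replicate_add]
    rfl

theorem sBlock_succ (k : ℕ) :
    sBlock (k + 1) = sBlock k ++ (List.replicate (3 ^ k) true ++ sBlock k) := by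
  induction k with
  | zero => rfl
  | succ k ih =>
    have h : ∀ j, sBlock (j + 1) = phi (sBlock j) := fun j => Function.iterate_succ_apply' phi j _
    rw [h (k + 1)]
    conv_lhs => rw [ih]
    rw [phi_append, phi_append, phi_replicate_true, ← h, pow_succ']

theorem length_sBlock (k : ℕ) : (sBlock k).length = 3 ^ k := by
  induction k with
  | zero => rfl
  | succ k ih => simp [sBlock_succ, ih]; ring

theorem isPal_sBlock (k : ℕ) : IsPal (sBlock k) := by
  induction k with
  | zero => rfl
  | succ k ih =>
    rw [IsPal] at ih
    simp [IsPal, sBlock_succ, ih]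

theorem sBlock_eq_cons (k : ℕ) : ∃ w, sBlock k = false :: w := by
  induction k with
  | zero => exact ⟨[], rfl⟩
  | succ k ih =>
    obtain ⟨w, hw⟩ := ih
    exact ⟨_, by rw [sBlock_succ, hw, List.cons_append]⟩

theorem head?_sBlock (k : ℕ) : (sBlock k).head? = some false := by
  obtain ⟨w, hw⟩ := sBlock_eq_cons k
  rw [hw, List.head?_cons]

theorem getLast?_sBlock (k : ℕ) : (sBlock k).getLast? = some false := by
  rw [← List.head?_reverse, isPal_sBlock k, head?_sBlock]

theorem sBlock_prefix {i j : ℕ} (h : i ≤ j) : sBlock i <+: sBlock j := by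
  induction j, h using Nat.le_induction with
  | base => exact List.prefix_rfl
  | succ j _ ih => exact ih.trans ⟨_, (sBlock_succ j).symm⟩

theorem sBlock_getElem?_eq {i j n : ℕ} (hi : n < 3 ^ i) (hj : n < 3 ^ j) :
    (sBlock i)[n]? = (sBlock j)[n]? := by
  wlog h : i ≤ j generalizing i j
  · exact (this hj hi (by omega)).symm
  obtain ⟨w, hw⟩ := sBlock_prefix h
  rw [← hw, List.getElem?_append_left (by rwa [length_sBlock])]

theorem sPrefix_eq_take {n k : ℕ} (h : n ≤ 3 ^ k) : sPrefix n = (sBlock k).take n := by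
  refine List.ext_getElem? fun i => ?_
  by_cases hi : i < n
  · have hi' : i < 3 ^ (i + 1) := i.lt_succ_self.trans (Nat.lt_pow_self (by norm_num))
    have hs : (sBlock (i + 1))[i]? = some (sW i) := by
      rw [sW, List.getD_eq_getElem?_getD]
      change _ = some ((sBlock (i + 1))[i]?.getD true)
      rw [List.getElem?_eq_getElem (by rwa [length_sBlock])]
      rfl
    rw [List.getElem?_take_of_lt hi, ← sBlock_getElem?_eq hi' (by omega), hs]
    simp [sPrefix, hi]
  · rw [List.getElem?_eq_none (by simp [sPrefix]; omega),
      List.getElem?_eq_none (by simp; omega)]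

theorem sPrefix_pow_add {i k : ℕ} (h : i ≤ 3 ^ k) :
    sPrefix (3 ^ k + i) = sBlock k ++ List.replicate i true := by
  rw [sPrefix_eq_take (k := k + 1) (by rw [pow_succ]; omega), sBlock_succ, List.take_append,
    length_sBlock, List.take_of_length_le (by rw [length_sBlock]; omega), Nat.add_sub_cancel_left,
    List.take_append_of_le_length (by simpa using h), List.take_replicate, min_eq_left h]

theorem sPrefix_two_mul_pow_add {m k : ℕ} (h : m ≤ 3 ^ k) :
    sPrefix (2 * 3 ^ k + m) = sBlock k ++ (List.replicate (3 ^ k) true ++ sPrefix m) := by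
  rw [sPrefix_eq_take (k := k + 1) (by rw [pow_succ]; omega), sBlock_succ, List.take_append,
    length_sBlock, List.take_of_length_le (by rw [length_sBlock]; omega), List.take_append,
    List.take_of_length_le (by simp; omega), List.length_replicate, sPrefix_eq_take h]
  congr 3
  omega

theorem length_sPrefix (n : ℕ) : (sPrefix n).length = n := by simp [sPrefix]

theorem head?_sPrefix {n : ℕ} (h : 0 < n) : (sPrefix n).head? = some false := by
  rw [sPrefix_eq_take (k := n) (Nat.lt_pow_self (by norm_num)).le, List.head?_take,
    if_neg (by omega), head?_sBlock]

end SierpinskiBlocks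

section Recursion

theorem palFactor_qj (j n : ℕ) : PalFactor (List.replicate j true ++ sPrefix n) (qj j n) :=
  palFactor_PL _

theorem qS_le {j n t : ℕ} (h : PalFactor (List.replicate j true ++ sPrefix n) t) : qS n ≤ t :=
  (Nat.sInf_le (Set.mem_range_self j) : qS n ≤ qj j n).trans (PL_le_iff.2 h)

theorem exists_qj_eq_qS (n : ℕ) : ∃ j, qj j n = qS n :=
  Nat.sInf_mem (s := Set.range fun j => qj j n) ⟨_, 0, rfl⟩

theorem not_isPal_of_head?_getLast? {w : List Bool} (h₀ : w.head? = some false)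
    (h₁ : w.getLast? = some true) : ¬IsPal w := by
  intro h
  rw [← List.head?_reverse, h, h₀] at h₁
  simp at h₁

theorem exists_mem_ne_true {y : List Bool} (h : y.head? = some false) : ∃ d ∈ y, d ≠ true :=
  ⟨false, List.mem_of_head? h, by simp⟩

theorem head?_of_append {y v : List Bool} {c : Bool} (hy : y ≠ [])
    (h : (y ++ v).head? = some c) : y.head? = some c := by
  rwa [List.head?_append_of_ne_nil _ hy] at h

/-- The minimum defining `qS n` is attained at some `j ≤ n`. -/
theorem exists_le_palFactor_qS {n : ℕ} (hn : 0 < n) :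
    ∃ j ≤ n, PalFactor (List.replicate j true ++ sPrefix n) (qS n) := by
  obtain ⟨j, hj⟩ := exists_qj_eq_qS n
  have h := palFactor_qj j n
  rw [hj] at h
  rcases h.split with ⟨a, b, hab, -, hb⟩ | ⟨u₁, x, y, v₂, a, b, hu, hv, -, hy, hxy, hab, -, hb⟩
  · exact ⟨0, by omega, hb.mono (by omega)⟩
  · obtain ⟨i, rfl⟩ : ∃ i, x = List.replicate i true :=
      ⟨x.length, (List.append_eq_replicate_iff.1 hu.symm).2.2⟩
    have hy0 := head?_of_append hy (hv ▸ head?_sPrefix hn)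
    have hlt := hxy.lt_length_of_replicate (exists_mem_ne_true hy0)
    have hlen := congrArg List.length hv
    rw [length_sPrefix, List.length_append] at hlen
    refine ⟨i, by omega, ?_⟩
    rw [hv, ← List.append_assoc]
    exact (hxy.palFactor.append hb).mono (by omega)

theorem pS_two_mul_pow_add_le {k m : ℕ} (hm : 0 < m) (hmk : m ≤ 3 ^ k) :
    pS (2 * 3 ^ k + m) ≤ 2 + qS m := by
  obtain ⟨j, hj, h⟩ := exists_le_palFactor_qS hm
  rw [pS, PL_le_iff, sPrefix_two_mul_pow_add hmk,
    show List.replicate (3 ^ k) true = List.replicate (3 ^ k - j) true ++ List.replicate j true by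
      rw [← List.replicate_add]; congr 1; omega, List.append_assoc]
  exact ((isPal_sBlock k).palFactor.append
    ((isPal_replicate _ _).palFactor.append h)).mono (by omega)

theorem sBlock_eq_sPrefix_append {m k : ℕ} (h : m ≤ 3 ^ k) : ∃ r, sBlock k = sPrefix m ++ r ∧
    sPrefix (3 ^ k - m) = r.reverse := by
  refine ⟨(sBlock k).drop m, by rw [sPrefix_eq_take h, List.take_append_drop], ?_⟩
  rw [sPrefix_eq_take (Nat.sub_le _ _), List.reverse_drop, isPal_sBlock, length_sBlock]

theorem pS_two_mul_pow_add_le_reflect {k m : ℕ} (hmk : m ≤ 3 ^ k) :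
    pS (2 * 3 ^ k + m) ≤ 1 + pS (3 ^ k - m) := by
  obtain ⟨r, hr, hr'⟩ := sBlock_eq_sPrefix_append hmk
  have hs : sBlock k = sPrefix (3 ^ k - m) ++ (sPrefix m).reverse := by
    rw [← isPal_sBlock k, hr', hr, List.reverse_append]
  have hpal : IsPal ((sPrefix m).reverse ++ (List.replicate (3 ^ k) true ++ sPrefix m)) := by
    simp [IsPal]
  rw [pS, PL_le_iff, sPrefix_two_mul_pow_add hmk, hs, List.append_assoc]
  exact ((palFactor_PL _).append hpal.palFactor).mono (by rw [pS]; omega)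

/-- A palindrome containing a long enough block of one letter, delimited on both sides by other
letters, is centred at that block. -/
theorem IsPal.eq_reverse_of_replicate {x y : List Bool} {n : ℕ}
    (h : IsPal (x ++ (List.replicate n true ++ y))) (hx : x.getLast? = some false)
    (hy : y.head? = some false) (hxn : x.length ≤ n) (hyn : y.length ≤ n) : x = y.reverse := by
  have key : ∀ {u v w w' : List Bool}, u.getLast? = some false → v ≠ [] → u.length ≤ n →
      v ++ (List.replicate n true ++ w) = u ++ w' → u.length ≤ v.length := by
    intro u v w w' hu hv hun he
    by_contra! hlt
    have hvl := List.length_pos_iff.2 hv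
    have h1 : u = (v ++ (List.replicate n true ++ w)).take u.length := by rw [he]; simp
    rw [List.take_append, List.take_of_length_le hlt.le,
      List.take_append_of_le_length (by simp; omega), List.take_replicate,
      min_eq_left (by omega)] at h1
    rw [h1, List.getLast?_append_of_ne_nil _ (by simp; omega), List.getLast?_replicate,
      if_neg (by omega)] at hu
    simp at hu
  have hyr : y.reverse.getLast? = some false := by rw [List.getLast?_reverse, hy]
  have h' : y.reverse ++ (List.replicate n true ++ x.reverse)
      = x ++ (List.replicate n true ++ y) := by
    rw [IsPal] at h
    simpa using h
  have hx0 : x ≠ [] := by rintro rfl; simp at hx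
  have hy0 : y.reverse ≠ [] := fun h0 => by simp [h0] at hyr
  have h₁ := key hx hy0 hxn h'
  have h₂ := key hyr hx0 (by simpa using hyn) h'.symm
  exact (List.append_inj h' (le_antisymm h₂ h₁)).1.symm

theorem pS_two_mul_pow_add_ge {k m : ℕ} (hm : 0 < m) (hmk : m ≤ 3 ^ k) :
    2 + qS m ≤ pS (2 * 3 ^ k + m) ∨ 1 + pS (3 ^ k - m) ≤ pS (2 * 3 ^ k + m) := by
  have h := palFactor_PL (sPrefix (2 * 3 ^ k + m))
  rw [← pS] at h
  generalize pS (2 * 3 ^ k + m) = t at h ⊢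
  rw [sPrefix_two_mul_pow_add hmk] at h
  have hpos : 0 < 3 ^ k := by positivity
  have hS0 : sBlock k ≠ [] := by
    obtain ⟨w, hw⟩ := sBlock_eq_cons k
    simp [hw]
  have hhead := head?_sPrefix hm
  have hlen := length_sPrefix m
  rcases h.split with ⟨a, b, hab, ha, hb⟩ |
    ⟨u₁, x, y, v₂, a, b, hu, hv, hx, hy, hxy, hab, ha, hb⟩
  · left
    have ha1 := ha.pos hS0
    rcases hb.split with ⟨c, d, hcd, hc, hd⟩ |
      ⟨u₁, x, y, v₂, c, d, hu, hv, -, hy, hxy, hcd, hc, hd⟩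
    · have hc1 := hc.pos (by simp)
      have := qS_le (j := 0) hd
      omega
    · obtain ⟨hl, hu₁, hx⟩ := List.append_eq_replicate_iff.1 hu.symm
      rw [hx] at hxy
      have hlt := hxy.lt_length_of_replicate
        (exists_mem_ne_true (head?_of_append hy (hv ▸ hhead)))
      rw [hv, List.length_append] at hlen
      have hc1 := hc.pos (by rintro rfl; simp at hl; omega)
      have hq := hxy.palFactor.append hd
      rw [List.append_assoc, ← hv] at hq
      have := qS_le hq
      omega
  · have hxlast : x.getLast? = some false := by
      have := getLast?_sBlock k
      rwa [hu, List.getLast?_append_of_ne_nil _ hx] at this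
    have of_replicate : ∀ i j, y = List.replicate i true →
        v₂ = List.replicate j true ++ sPrefix m → 2 + qS m ≤ t := by
      intro i j hyi hvj
      rw [hvj] at hb
      have := qS_le hb
      have ha1 := ha.pos <| by
        rintro rfl
        refine not_isPal_of_head?_getLast? ?_ ?_ hxy
        · rw [List.head?_append_of_ne_nil _ hx, ← List.nil_append x, ← hu, head?_sBlock]
        · rw [List.getLast?_append_of_ne_nil _ hy, hyi, List.getLast?_replicate,
            if_neg (by rintro rfl; exact hy hyi)]
      omega
    rcases List.append_eq_append_iff.1 hv with ⟨y', rfl, hy'⟩ | ⟨z, hz, hv₂⟩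
    · by_cases hy0 : y' = []
      · subst hy0
        exact Or.inl (of_replicate (3 ^ k) 0 (List.append_nil _) (by simpa using hy'.symm))
      · right
        have hSlen := length_sBlock k
        rw [hu, List.length_append] at hSlen
        rw [hy', List.length_append] at hlen
        have hxy' := hxy.eq_reverse_of_replicate hxlast
          (head?_of_append hy0 (hy' ▸ hhead)) (by omega) (by omega)
        obtain ⟨r, hr, hr'⟩ := sBlock_eq_sPrefix_append hmk
        have hu₁ : u₁ = r.reverse ++ v₂.reverse := by
          have he := isPal_sBlock k
          rw [IsPal] at he
          nth_rw 1 [hr] at he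
          rw [hu, hy', hxy', List.reverse_append, List.reverse_append, ← List.append_assoc] at he
          exact (List.append_inj' he rfl).1.symm
        rw [hu₁] at ha
        have hp := PL_le_iff.2 (ha.of_append hb.reverse)
        rw [← hr', ← pS] at hp
        omega
    · obtain ⟨-, hyr, hzr⟩ := List.append_eq_replicate_iff.1 hz.symm
      exact Or.inl (of_replicate _ z.length hyr (by rwa [← hzr]))

theorem pS_pow_add {k i : ℕ} (hi : 0 < i) (hik : i ≤ 3 ^ k) : pS (3 ^ k + i) = 2 := by
  have hhead := head?_sPrefix (n := 3 ^ k + i) (by omega)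
  have hlast : (sPrefix (3 ^ k + i)).getLast? = some true := by
    rw [sPrefix_pow_add hik, List.getLast?_append_of_ne_nil _ (by simp; omega),
      List.getLast?_replicate, if_neg (by omega)]
  have hpal := not_isPal_of_head?_getLast? hhead hlast
  refine le_antisymm ?_ ?_
  · rw [pS, PL_le_iff, sPrefix_pow_add hik]
    exact (isPal_sBlock k).palFactor.append (isPal_replicate _ _).palFactor
  · by_contra! hlt
    exact hpal (palFactor_one.1 (PL_le_iff.1 (Nat.le_of_lt_succ hlt)))

end Recursion

/-- The recursion for the prefix palindromic length p of the Sierpinski word: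
p(0) = 0, p(1) = 1, p(n) = 2 for 3ᵏ < n ≤ 2·3ᵏ, and
p(n) = min(2 + q(n − 2·3ᵏ), 1 + p(3ᵏ⁺¹ − n)) for 2·3ᵏ < n ≤ 3ᵏ⁺¹. -/
theorem p_recursion :
    pS 0 = 0 ∧
    pS 1 = 1 ∧
    (∀ k n : ℕ, 3 ^ k < n → n ≤ 2 * 3 ^ k → pS n = 2) ∧
    (∀ k n : ℕ, 2 * 3 ^ k < n → n ≤ 3 ^ (k + 1) →
      pS n = min (2 + qS (n - 2 * 3 ^ k)) (1 + pS (3 ^ (k + 1) - n))) := by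
  refine ⟨Nat.le_zero.1 (PL_le_iff.2 PalFactor.nil), ?_, fun k n h₁ h₂ => ?_,
    fun k n h₁ h₂ => ?_⟩
  · refine le_antisymm (PL_le_iff.2 (palFactor_one.2 rfl)) ((palFactor_PL _).pos ?_)
    simp [sPrefix]
  · obtain ⟨i, rfl⟩ := Nat.exists_eq_add_of_lt h₁
    exact pS_pow_add (i := i + 1) (by omega) (by omega)
  · obtain ⟨m, rfl⟩ := Nat.exists_eq_add_of_le h₁.le
    have hm : 0 < m := by omega
    rw [pow_succ] at h₂ ⊢
    have hmk : m ≤ 3 ^ k := by omega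
    rw [Nat.add_sub_cancel_left, show 3 ^ k * 3 - (2 * 3 ^ k + m) = 3 ^ k - m by omega]
    have := pS_two_mul_pow_add_le hm hmk
    have := pS_two_mul_pow_add_le_reflect hmk
    have := pS_two_mul_pow_add_ge hm hmk
    omega
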